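/- Fix integers $d,m\ge 1$, let $\mathcal M=\{1,\dots,m\}$, and write $B(x,r)$ for the open Euclidean ball. A domain is a nonempty connected open set. Let $b(\cdot,i):\mathbb R^d\to\mathbb R^d$, $\sigma(\cdot,i):\mathbb R^d\to\mathbb R^{d\times d}$, $q_{ij}:\mathbb R^d\to\mathbb R$ and Borel functions $\tilde\pi_i:\mathbb R^d\times\mathbb R^d\to[0,\infty)$ $(i,j\in\mathcal M)$ be given; put $a=\sigma\sigma^{T}$ and $\pi_i(x,dz)=\tilde\pi_i(x,z)\,dz$, and assume: (A1) $\sigma(\cdot,i)$ and $b(\cdot,i)$ are continuous and $\sum_{k,l}|\sigma_{kl}(x,i)|+\sum_k|b_k(x,i)|\le c(1+|x|)$ for some $c>0$; the $q_{ij}$ are bounded and Borel, $q_{ij}\ge 0$ for $i\ne j$, and $\sum_{j}q_{ij}(x)=0$. (A2) For every bounded domain $E\subset\mathbb R^d$ there is $\kappa_0\in(0,1]$ with $\kappa_0|\xi|^2\le \xi^{T}a(x,i)\xi\le\kappa_0^{-1}|\xi|^2$ for all $\xi\in\mathbb R^d$, $x\in E$, $i\in\mathcal M$. (A3) $\int(1\wedge|z|^2)\,\pi_i(x,dz)<\infty$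 for all $x,i$; $\sup_{x,i}\pi_i(x,B(0,1)^c)<\infty$; $\int_{B(0,1)}|z|^2\pi_i(x,dz)\le c(1+|x|^2)$ for some $c>0$ and all $x,i$; and for every integer $n\ge1$ there is a $\sigma$-finite measure $\Pi_n$ with $\int(1\wedge|z|^2)\,\Pi_n(dz)<\infty$ and $\pi_i(x,\cdot)\le\Pi_n$ for all $x\in B(0,n)$, $i\in\mathcal M$. (A4) There are $\kappa_2,\beta>0$ such that for every $r\in(0,1)$ there is $\alpha_r$ with $1<\alpha_r<\kappa_2r^{-\beta}$ and $\tilde\pi_i(x,z-x)\le\alpha_r\tilde\pi_i(y,z-y)$ for all $x_0\in\mathbb R^d$, $x,y\in B(x_0,r/2)$, $z\in B(x_0,r)^c$, $i\in\mathcal M$. For $f:\mathbb R^d\times\mathcal M\to\mathbb R$ with $f(\cdot,i)\in C^2(\mathbb R^d)$ let $$\mathcal Gf(x,i)=\tfrac12\sum_{k,l}a_{kl}(x,i)\frac{\partial^2f(x,i)}{\partial x_k\partial x_l}+\sum_kb_k(x,i)\frac{\partial f(x,i)}{\partial x_k}+\int_{\mathbb R^d}\big[f(x+z,i)-f(x,i)-\nabla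 f(x,i)\cdot z\,\mathbf 1_{\{|z|<1\}}\big]\pi_i(x,dz)+\sum_{j\in\mathcal M}q_{ij}(x)f(x,j)$$ whenever the integral exists. Let $(X(t),\Lambda(t))_{t\ge0}$ be the coordinate process on the space of càdlàg paths $[0,\infty)\to\mathbb R^d\times\mathcal M$, with the right continuous filtration it generates. For each $(x,i)$ let $\mathbb P_{x,i}$ be a probability measure on that space solving the martingale problem for $(\mathcal G,C_b^2(\mathbb R^d))$ started at $(x,i)$: $\mathbb P_{x,i}(X(0)=x,\Lambda(0)=i)=1$, and $f(X(t),\Lambda(t))-f(X(0),\Lambda(0))-\int_0^t\mathcal Gf(X(s),\Lambda(s))\,ds$ is a $\mathbb P_{x,i}$-martingale for every $f$ such that each $f(\cdot,i)$ is $C^2$ with bounded derivatives of orders $0,1,2$. Let $D\subset\mathbb R^d$ be a bounded domain and $U=D\times\mathcal M$, and suppose condition (C2) holds: for each $i\in\mathcal M$ there is a nonnegative function $V(\cdot,i)\in C^2(\mathbb R^d)$ such that $\mathcal GV(x,i)\le0$ for all $(x,i)\in D^c\times\mathcal M$ (in particular the integral in $\mathcal GV(x,i)$, which for such $V$ always exists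 in $(-\infty,\infty]$, is finite there), and $\inf\{V(x,i):|x|\ge n,\ i\in\mathcal M\}\to\infty$ as $n\to\infty$. Then the process is recurrent with respect to $U$: with $\sigma_U=\inf\{t\ge0:(X(t),\Lambda(t))\in U\}$, $$\mathbb P_{x,i}(\sigma_U<\infty)=1\qquad\text{for every }(x,i)\in U^c.$$ -/

import Mathlib

open MeasureTheory Set Filter Metric Matrix
open scoped NNReal ENNReal Topology

noncomputable section

/-- The Euclidean space `ℝ^d`. -/
abbrev Rd (d : ℕ) : Type := EuclideanSpace ℝ (Fin d)

/-- A bounded domain of `ℝ^d`: a nonempty connected bounded open set. -/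
def BddDomain {d : ℕ} (D : Set (Rd d)) : Prop :=
  IsOpen D ∧ IsConnected D ∧ Bornology.IsBounded D

/-- The coefficients of a switching jump diffusion on `ℝ^d × {1,…,m}`. This is only data:
the drift `b`, the matrix `σ`, the switching rates `q x i j = q_{ij}(x)` and the jump density
`πd x i z = π̃_i(x,z)`. -/
structure Coeffs (d m : ℕ) where
  b : Rd d → Fin m → Rd d
  σ : Rd d → Fin m → Matrix (Fin d) (Fin d) ℝ
  q : Rd d → Fin m → Fin m → ℝ
  πd : Rd d → Fin m → Rd d → ℝ

namespace Coeffs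

variable {d m : ℕ} (C : Coeffs d m)

/-- The diffusion matrix `a = σ σᵀ`. -/
def a (x : Rd d) (i : Fin m) : Matrix (Fin d) (Fin d) ℝ :=
  C.σ x i * (C.σ x i)ᵀ

/-- The jump measure `π_i(x,dz) = π̃_i(x,z) dz`. -/
def π (x : Rd d) (i : Fin m) : Measure (Rd d) :=
  volume.withDensity fun z => ENNReal.ofReal (C.πd x i z)

/-- The standing assumptions on the coefficients. -/
structure Assumptions : Prop where
  -- continuity and linear growth of `σ` and `b`
  σ_cont : ∀ i, Continuous fun x => C.σ x i
  b_cont : ∀ i, Continuous fun x => C.b x i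
  growth : ∃ c > (0 : ℝ), ∀ x i,
    (∑ k, ∑ l, |C.σ x i k l|) + ∑ k, |C.b x i k| ≤ c * (1 + ‖x‖)
  -- `Q(x)` is a bounded Borel `Q`-matrix
  q_meas : ∀ i j, Measurable fun x => C.q x i j
  q_bdd : ∀ i j, ∃ K : ℝ, ∀ x, |C.q x i j| ≤ K
  q_nonneg : ∀ x i j, i ≠ j → 0 ≤ C.q x i j
  q_rowsum : ∀ x i, ∑ j, C.q x i j = 0
  -- local uniform ellipticity of `a`
  elliptic : ∀ D : Set (Rd d), BddDomain D →
    ∃ κ₀ ∈ Set.Ioc (0 : ℝ) 1, ∀ (ξ : Rd d), ∀ x ∈ D, ∀ i,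
      κ₀ * ‖ξ‖ ^ 2 ≤ ∑ k, ∑ l, ξ k * C.a x i k l * ξ l ∧
      ∑ k, ∑ l, ξ k * C.a x i k l * ξ l ≤ κ₀⁻¹ * ‖ξ‖ ^ 2
  -- the jump density is nonnegative and Borel, and `π_i(x,·)` is a Lévy measure
  πd_nonneg : ∀ x i z, 0 ≤ C.πd x i z
  πd_meas : ∀ i, Measurable fun p : Rd d × Rd d => C.πd p.1 i p.2
  levy : ∀ x i, (∫⁻ z, ENNReal.ofReal (min 1 (‖z‖ ^ 2)) ∂(C.π x i)) < ⊤
  -- bounds on large and small jumps, and local domination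
  large_jumps : ∃ K : ℝ≥0, ∀ x i, C.π x i (ball (0 : Rd d) 1)ᶜ ≤ K
  small_jumps : ∃ c > (0 : ℝ), ∀ x i,
    (∫⁻ z in ball (0 : Rd d) 1, ENNReal.ofReal (‖z‖ ^ 2) ∂(C.π x i))
      ≤ ENNReal.ofReal (c * (1 + ‖x‖ ^ 2))
  domination : ∀ n : ℕ, 1 ≤ n → ∃ Pin : Measure (Rd d), SigmaFinite Pin ∧
    (∫⁻ z, ENNReal.ofReal (min 1 (‖z‖ ^ 2)) ∂Pin) < ⊤ ∧
    ∀ x ∈ ball (0 : Rd d) n, ∀ i, C.π x i ≤ Pin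
  -- comparability of the jump densities from nearby points
  comparability : ∃ κ₂ > (0 : ℝ), ∃ β > (0 : ℝ), ∀ r ∈ Set.Ioo (0 : ℝ) 1, ∃ αr : ℝ,
    1 < αr ∧ αr < κ₂ * r ^ (-β) ∧
    ∀ x₀ : Rd d, ∀ x ∈ ball x₀ (r / 2), ∀ y ∈ ball x₀ (r / 2), ∀ z ∈ (ball x₀ r)ᶜ, ∀ i,
      C.πd x i (z - x) ≤ αr * C.πd y i (z - y)

/-- The integrand `f(x+z,i) − f(x,i) − ∇f(x,i)·z 1_{|z|<1}` of the jump part of `G`. -/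
def jumpIntegrand (f : Rd d → Fin m → ℝ) (x : Rd d) (i : Fin m) (z : Rd d) : ℝ :=
  f (x + z) i - f x i - (if ‖z‖ < 1 then fderiv ℝ (fun y => f y i) x z else 0)

/-- The generator
`Gf(x,i) = ½ Σ a_{kl} ∂²f/∂x_k∂x_l + Σ b_k ∂f/∂x_k
  + ∫ [f(x+z,i) − f(x,i) − ∇f(x,i)·z 1_{|z|<1}] π_i(x,dz) + Σ_j q_{ij}(x) f(x,j)`.
The value is meaningful where the jump integrand is `π_i(x,·)`-integrable, which holds
at every point for bounded `f ∈ C²` under the standing assumptions. -/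
def G (f : Rd d → Fin m → ℝ) (x : Rd d) (i : Fin m) : ℝ :=
  (1 / 2) * ∑ k, ∑ l, C.a x i k l *
      iteratedFDeriv ℝ 2 (fun y => f y i) x
        ![EuclideanSpace.single k (1 : ℝ), EuclideanSpace.single l (1 : ℝ)]
    + ∑ k, C.b x i k * fderiv ℝ (fun y => f y i) x (EuclideanSpace.single k (1 : ℝ))
    + ∫ z, jumpIntegrand f x i z ∂(C.π x i)
    + ∑ j, C.q x i j * f x j

/-- Condition (C2) with respect to `D × M`. For a nonnegative `V(·,i) ∈ C²` the jump integral
in `GV(x,i)` always exists in `(-∞, ∞]`, and it is finite exactly when the integrand is integrable,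
so the statement `GV(x,i) ≤ 0` consists of the integrability and the inequality. -/
def ConditionC2 (D : Set (Rd d)) : Prop :=
  ∃ V : Rd d → Fin m → ℝ,
    (∀ i, ContDiff ℝ 2 fun y => V y i) ∧
    (∀ x i, 0 ≤ V x i) ∧
    (∀ x ∈ Dᶜ, ∀ i, Integrable (jumpIntegrand V x i) (C.π x i) ∧ C.G V x i ≤ 0) ∧
    Tendsto (fun n : ℕ => sInf {v : ℝ | ∃ x i, (n : ℝ) ≤ ‖x‖ ∧ v = V x i}) atTop atTop

end Coeffs

/-- `f(·,i) ∈ C_b²(ℝ^d)` for each `i`: `C²` with bounded derivatives of orders `0, 1, 2`. -/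
def IsCb2 {d m : ℕ} (f : Rd d → Fin m → ℝ) : Prop :=
  ∀ i, ContDiff ℝ 2 (fun y => f y i) ∧
    ∃ K : ℝ, ∀ x, |f x i| ≤ K ∧ ‖fderiv ℝ (fun y => f y i) x‖ ≤ K ∧
      ‖iteratedFDeriv ℝ 2 (fun y => f y i) x‖ ≤ K

/-- Right continuous with left limits. -/
def IsCadlag {E : Type*} [TopologicalSpace E] (w : ℝ≥0 → E) : Prop :=
  (∀ t, ContinuousWithinAt w (Set.Ici t) t) ∧
    ∀ t, 0 < t → ∃ L : E, Tendsto w (𝓝[<] t) (𝓝 L)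

/-- The canonical space `D([0,∞), ℝ^d × M)` of càdlàg paths. Its σ-algebra is the one generated
by the coordinate maps, which is the Borel σ-algebra of the Skorokhod topology. -/
abbrev PathSpace (d m : ℕ) : Type := {w : ℝ≥0 → Rd d × Fin m // IsCadlag w}

namespace PathSpace

variable {d m : ℕ}

/-- The canonical process `(X(t), Λ(t))`. -/
def Z (t : ℝ≥0) (w : PathSpace d m) : Rd d × Fin m := w.1 t

/-- The component `X(t)`. -/
def X (t : ℝ≥0) (w : PathSpace d m) : Rd d := (Z t w).1

/-- The switching component `Λ(t)`. -/
def Λ (t : ℝ≥0) (w : PathSpace d m) : Fin m := (Z t w).2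

theorem measurable_Z (t : ℝ≥0) : Measurable (Z t : PathSpace d m → Rd d × Fin m) :=
  (measurable_pi_apply t).comp measurable_subtype_coe

/-- The right continuous filtration generated by `(X(t), Λ(t))`. -/
def ℱ (d m : ℕ) : Filtration ℝ≥0 (inferInstance : MeasurableSpace (PathSpace d m)) :=
  (Filtration.natural (Z : ℝ≥0 → PathSpace d m → Rd d × Fin m)
    fun t => (measurable_Z t).stronglyMeasurable).rightCont

/-- The first entrance time `σ_U = inf{t ≥ 0 : (X(t), Λ(t)) ∈ U}`, with `inf ∅ = ∞`. -/
def entrance (U : Set (Rd d × Fin m)) (w : PathSpace d m) : ℝ≥0∞ :=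
  ⨅ (t : ℝ≥0) (_ : Z t w ∈ U), (t : ℝ≥0∞)

end PathSpace

open PathSpace in
/-- `P` is a solution to the martingale problem for `(G, C_b²(ℝ^d))` started at `(x,i)`. -/
structure SolvesMP {d m : ℕ} (C : Coeffs d m) (x : Rd d) (i : Fin m)
    (P : Measure (PathSpace d m)) : Prop where
  prob : IsProbabilityMeasure P
  init : P {w | X 0 w = x ∧ Λ 0 w = i} = 1
  mart : ∀ f : Rd d → Fin m → ℝ, IsCb2 f →
    Martingale
      (fun (t : ℝ≥0) (w : PathSpace d m) => f (X t w) (Λ t w) - f (X 0 w) (Λ 0 w) -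
        ∫ s in (0 : ℝ)..t, C.G f (X s.toNNReal w) (Λ s.toNNReal w))
      (ℱ d m) P

/-- The process with laws `P_{x,i}` is recurrent with respect to `U`:
`P_{x,i}(σ_U < ∞) = 1` for every `(x,i) ∈ Uᶜ`. -/
def Recurrent {d m : ℕ} (P : Rd d → Fin m → Measure (PathSpace d m))
    (U : Set (Rd d × Fin m)) : Prop :=
  ∀ x i, (x, i) ∈ Uᶜ → P x i {w | PathSpace.entrance U w < ⊤} = 1

end

/-- Each `f(·,i)` is a `C²` function with compact support. -/
def IsCc2 {d m : ℕ} (f : Rd d → Fin m → ℝ) : Prop :=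
  ∀ i, ContDiff ℝ 2 (fun y => f y i) ∧ HasCompactSupport (fun y => f y i)

namespace IsCc2

variable {d m : ℕ} {f : Rd d → Fin m → ℝ}

theorem isCb2 (hf : IsCc2 f) : IsCb2 f := by
  intro i
  obtain ⟨h, hs⟩ := hf i
  obtain ⟨K₀, h₀⟩ := hs.exists_bound_of_continuous h.continuous
  obtain ⟨K₁, h₁⟩ := (hs.fderiv ℝ).exists_bound_of_continuous
    (h.continuous_fderiv (by norm_num))
  obtain ⟨K₂, h₂⟩ := (hs.iteratedFDeriv (𝕜 := ℝ) 2).exists_bound_of_continuous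
    (h.continuous_iteratedFDeriv (m := 2) (by norm_num))
  refine ⟨h, max K₀ (max K₁ K₂), fun x => ⟨?_, ?_, ?_⟩⟩
  · exact (h₀ x).trans (le_max_left _ _)
  · exact (h₁ x).trans ((le_max_left _ _).trans (le_max_right _ _))
  · exact (h₂ x).trans ((le_max_right _ _).trans (le_max_right _ _))

theorem exists_abs_le (hf : IsCc2 f) : ∃ K : ℝ, 0 ≤ K ∧ ∀ x i, |f x i| ≤ K := by
  choose h K hK using hf.isCb2
  refine ⟨∑ i, |K i|, Finset.sum_nonneg fun _ _ => abs_nonneg _, fun x i => ?_⟩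
  exact ((hK i x).1.trans (le_abs_self _)).trans
    (Finset.single_le_sum (f := fun i => |K i|) (fun _ _ => abs_nonneg _) (Finset.mem_univ i))

theorem exists_radius (hf : IsCc2 f) : ∃ R : ℝ, 0 ≤ R ∧ ∀ x i, R < ‖x‖ →
    f x i = 0 ∧ fderiv ℝ (fun y => f y i) x = 0 := by
  have : ∀ i, ∃ R : ℝ, tsupport (fun y => f y i) ⊆ closedBall 0 R := fun i =>
    (hf i).2.isCompact.isBounded.subset_closedBall 0
  choose R hR using this
  refine ⟨∑ i, |R i|, Finset.sum_nonneg fun _ _ => abs_nonneg _, fun x i hx => ?_⟩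
  have hx' : x ∉ tsupport (fun y => f y i) := by
    intro h
    have h1 := hR i h
    rw [mem_closedBall_zero_iff] at h1
    have := Finset.single_le_sum (f := fun i => |R i|) (fun _ _ => abs_nonneg _)
      (Finset.mem_univ i)
    have := le_abs_self (R i)
    linarith
  exact ⟨image_eq_zero_of_notMem_tsupport (f := fun y => f y i) hx', by
    by_contra h
    exact hx' (support_fderiv_subset ℝ h)⟩

theorem exists_taylor (hf : IsCc2 f) : ∃ K : ℝ, 0 ≤ K ∧ ∀ x i z,
    |f (x + z) i - f x i - fderiv ℝ (fun y => f y i) x z| ≤ K * ‖z‖ ^ 2 := by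
  have : ∀ i, ∃ L, LipschitzWith L (fderiv ℝ fun y => f y i) := fun i =>
    ((hf i).1.fderiv_right (m := 1) (by norm_num)).lipschitzWith_of_hasCompactSupport
      ((hf i).2.fderiv ℝ) (by norm_num)
  choose L hL using this
  refine ⟨∑ i, (L i : ℝ), Finset.sum_nonneg fun _ _ => NNReal.coe_nonneg _, fun x i z => ?_⟩
  have h1 : ‖f (x + z) i - f x i - fderiv ℝ (fun y => f y i) x (x + z - x)‖ ≤
      (L i * ‖z‖) * ‖x + z - x‖ := by
    refine (convex_closedBall x ‖z‖).norm_image_sub_le_of_norm_hasFDerivWithin_le'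
      (f := fun y => f y i) (f' := fderiv ℝ fun y => f y i) ?_ ?_ (by simp) (by simp)
    · intro y _
      exact ((hf i).1.differentiable (by norm_num) y).hasFDerivAt.hasFDerivWithinAt
    · intro y hy
      have := (hL i).dist_le_mul y x
      rw [dist_eq_norm] at this
      exact this.trans (by gcongr; exact hy)
  rw [add_sub_cancel_left, Real.norm_eq_abs] at h1
  have h2 : (L i : ℝ) ≤ ∑ i, (L i : ℝ) :=
    Finset.single_le_sum (f := fun i => (L i : ℝ)) (fun _ _ => NNReal.coe_nonneg _)
      (Finset.mem_univ i)
  calc _ ≤ (L i : ℝ) * ‖z‖ * ‖z‖ := h1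
    _ = L i * ‖z‖ ^ 2 := by ring
    _ ≤ _ := by gcongr

end IsCc2

namespace Coeffs

variable {d m : ℕ} {C : Coeffs d m} {f : Rd d → Fin m → ℝ}

theorem measurable_jumpIntegrand (hf : ∀ i, ContDiff ℝ 2 fun y => f y i) (i : Fin m) :
    Measurable fun p : Rd d × Rd d => jumpIntegrand f p.1 i p.2 := by
  unfold jumpIntegrand
  have hc := (hf i).continuous
  have hd : Continuous fun p : Rd d × Rd d => fderiv ℝ (fun y => f y i) p.1 p.2 :=
    (((hf i).continuous_fderiv (by norm_num)).comp continuous_fst).clm_apply continuous_snd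
  refine Measurable.sub (Continuous.measurable ?_) (Measurable.ite ?_ hd.measurable
    measurable_const)
  · exact (hc.comp (continuous_fst.add continuous_snd)).sub (hc.comp continuous_fst)
  · exact measurableSet_lt measurable_snd.norm measurable_const

theorem jumpIntegrand_le (hf : IsCc2 f) : ∃ K : ℝ, 0 ≤ K ∧ ∀ x i z,
    |jumpIntegrand f x i z| ≤ K * min 1 (‖z‖ ^ 2) := by
  obtain ⟨K₀, h₀, hK₀⟩ := hf.exists_abs_le
  obtain ⟨K₁, h₁, hK₁⟩ := hf.exists_taylor
  refine ⟨2 * K₀ + K₁, by positivity, fun x i z => ?_⟩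
  unfold jumpIntegrand
  split_ifs with hz
  · rw [min_eq_right (by nlinarith [norm_nonneg z])]
    refine (hK₁ x i z).trans ?_
    gcongr
    linarith
  · rw [min_eq_left (by nlinarith [norm_nonneg z]), sub_zero]
    have := abs_sub (f (x + z) i) (f x i)
    linarith [hK₀ (x + z) i, hK₀ x i]

theorem Assumptions.integrable_jumpIntegrand (hC : C.Assumptions) (hf : IsCc2 f) (x : Rd d)
    (i : Fin m) : Integrable (jumpIntegrand f x i) (C.π x i) := by
  obtain ⟨K, hK, h⟩ := jumpIntegrand_le hf
  have hm : Integrable (fun z : Rd d => min 1 (‖z‖ ^ 2)) (C.π x i) := by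
    refine ⟨(by fun_prop : Measurable fun z : Rd d => min 1 (‖z‖ ^ 2)).aestronglyMeasurable, ?_⟩
    rw [hasFiniteIntegral_iff_ofReal (ae_of_all _ fun z => by positivity)]
    exact hC.levy x i
  refine (hm.const_mul K).mono' ?_ (ae_of_all _ fun z => h x i z)
  exact ((measurable_jumpIntegrand (fun i => (hf i).1) i).comp
    measurable_prodMk_left).aestronglyMeasurable

theorem Assumptions.exists_abs_integral_jumpIntegrand_le (hC : C.Assumptions) (hf : IsCc2 f) :
    ∃ K : ℝ, ∀ x i, |∫ z, jumpIntegrand f x i z ∂(C.π x i)| ≤ K := by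
  obtain ⟨K, hK, h⟩ := jumpIntegrand_le hf
  obtain ⟨R, hR0, hR⟩ := hf.exists_radius
  obtain ⟨L, hL⟩ := hC.large_jumps
  obtain ⟨c, hc, hs⟩ := hC.small_jumps
  set A : ℝ≥0∞ := ENNReal.ofReal K * ENNReal.ofReal (c * (1 + (R + 1) ^ 2)) +
    ENNReal.ofReal K * L with hA
  have hAt : A ≠ ⊤ := by simp [hA, ENNReal.mul_eq_top]
  refine ⟨A.toReal, fun x i => ?_⟩
  rw [← Real.norm_eq_abs]
  refine (norm_integral_le_lintegral_norm _).trans (ENNReal.toReal_mono hAt ?_)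
  rw [← lintegral_add_compl _ (measurableSet_ball (x := (0 : Rd d)) (ε := 1))]
  refine add_le_add ?_ ?_
  · by_cases hx : ‖x‖ ≤ R + 1
    · calc _ ≤ ∫⁻ z in ball (0 : Rd d) 1, ENNReal.ofReal K * ENNReal.ofReal (‖z‖ ^ 2)
            ∂(C.π x i) := by
            refine lintegral_mono fun z => ?_
            rw [← ENNReal.ofReal_mul hK]
            refine ENNReal.ofReal_le_ofReal ((h x i z).trans ?_)
            gcongr
            exact min_le_right _ _
        _ = ENNReal.ofReal K * ∫⁻ z in ball (0 : Rd d) 1, ENNReal.ofReal (‖z‖ ^ 2)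
            ∂(C.π x i) := lintegral_const_mul _ (by fun_prop)
        _ ≤ _ := by
            gcongr
            exact (hs x i).trans (ENNReal.ofReal_le_ofReal (by gcongr))
    · have : ∫⁻ z in ball (0 : Rd d) 1, ENNReal.ofReal ‖jumpIntegrand f x i z‖ ∂(C.π x i) = 0 := by
        refine setLIntegral_eq_zero measurableSet_ball fun z hz => ?_
        rw [mem_ball_zero_iff] at hz
        push Not at hx
        have hxz : R < ‖x + z‖ := by
          have := norm_sub_le (x + z) z
          rw [add_sub_cancel_right] at this
          linarith
        have hx' : R < ‖x‖ := by linarith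
        simp [jumpIntegrand, (hR _ i hxz).1, hR x i hx']
      rw [this]
      exact bot_le
  · calc _ ≤ ∫⁻ z in (ball (0 : Rd d) 1)ᶜ, ENNReal.ofReal K ∂(C.π x i) := by
          refine lintegral_mono fun z => ENNReal.ofReal_le_ofReal ((h x i z).trans ?_)
          exact mul_le_of_le_one_right hK (min_le_left _ _)
      _ = ENNReal.ofReal K * C.π x i (ball (0 : Rd d) 1)ᶜ := setLIntegral_const _ _
      _ ≤ _ := by
          gcongr
          exact hL x i

theorem Assumptions.measurable_integral_jumpIntegrand (hC : C.Assumptions)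
    (hf : ∀ i, ContDiff ℝ 2 fun y => f y i) (i : Fin m) :
    Measurable fun x => ∫ z, jumpIntegrand f x i z ∂(C.π x i) := by
  have h1 : ∀ x, ∫ z, jumpIntegrand f x i z ∂(C.π x i) =
      ∫ z, C.πd x i z * jumpIntegrand f x i z := by
    intro x
    unfold π
    have hm : Measurable fun z => ENNReal.ofReal (C.πd x i z) :=
      ((hC.πd_meas i).comp measurable_prodMk_left).ennreal_ofReal
    rw [integral_withDensity_eq_integral_toReal_smul hm
      (ae_of_all _ fun z => ENNReal.ofReal_lt_top)]
    refine integral_congr_ae (ae_of_all _ fun z => ?_)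
    simp [ENNReal.toReal_ofReal (hC.πd_nonneg x i z)]
  simp_rw [h1]
  have h2 : Measurable fun p : Rd d × Rd d => C.πd p.1 i p.2 * jumpIntegrand f p.1 i p.2 :=
    (hC.πd_meas i).mul (measurable_jumpIntegrand hf i)
  exact (StronglyMeasurable.integral_prod_right' h2.stronglyMeasurable).measurable

theorem Assumptions.continuous_a (hC : C.Assumptions) (i : Fin m) (k l : Fin d) :
    Continuous fun x => C.a x i k l := by
  have : Continuous fun x => C.a x i := (hC.σ_cont i).matrix_mul (hC.σ_cont i).matrix_transpose
  exact this.matrix_elem k l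

theorem Assumptions.continuous_b (hC : C.Assumptions) (i : Fin m) (k : Fin d) :
    Continuous fun x => C.b x i k :=
  (PiLp.continuous_apply 2 _ k).comp (hC.b_cont i)

theorem continuous_second (hf : ∀ i, ContDiff ℝ 2 fun y => f y i) (i : Fin m) (v : Fin 2 → Rd d) :
    Continuous fun x => iteratedFDeriv ℝ 2 (fun y => f y i) x v :=
  (ContinuousMultilinearMap.apply ℝ (fun _ : Fin 2 => Rd d) ℝ v).continuous.comp
    ((hf i).continuous_iteratedFDeriv (m := 2) (by norm_num))

theorem continuous_first (hf : ∀ i, ContDiff ℝ 2 fun y => f y i) (i : Fin m) (v : Rd d) :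
    Continuous fun x => fderiv ℝ (fun y => f y i) x v :=
  ((hf i).continuous_fderiv (by norm_num)).clm_apply continuous_const

theorem Assumptions.measurable_G (hC : C.Assumptions) (hf : ∀ i, ContDiff ℝ 2 fun y => f y i)
    (i : Fin m) : Measurable fun x => C.G f x i := by
  unfold G
  refine ((Measurable.add ?_ ?_).add (hC.measurable_integral_jumpIntegrand hf i)).add ?_
  · refine Continuous.measurable (continuous_const.mul ?_)
    exact continuous_finsetSum _ fun k _ => continuous_finsetSum _ fun l _ =>
      (hC.continuous_a i k l).mul (continuous_second hf i _)
  · refine Continuous.measurable (continuous_finsetSum _ fun k _ => ?_)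
    exact (hC.continuous_b i k).mul (continuous_first hf i _)
  · exact Finset.measurable_sum _ fun j _ => (hC.q_meas i j).mul (hf j).continuous.measurable

theorem Assumptions.exists_abs_G_le (hC : C.Assumptions) (hf : IsCc2 f) :
    ∃ K : ℝ, 0 ≤ K ∧ ∀ x i, |C.G f x i| ≤ K := by
  have hf' := fun i => (hf i).1
  have h1 : ∀ i, ∃ K : ℝ, ∀ x, ‖(1 / 2) * ∑ k, ∑ l, C.a x i k l *
      iteratedFDeriv ℝ 2 (fun y => f y i) x
        ![EuclideanSpace.single k (1 : ℝ), EuclideanSpace.single l (1 : ℝ)]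
    + ∑ k, C.b x i k * fderiv ℝ (fun y => f y i) x (EuclideanSpace.single k (1 : ℝ))‖ ≤ K := by
    intro i
    refine HasCompactSupport.exists_bound_of_continuous ?_ ?_
    · refine HasCompactSupport.intro (hf i).2.isCompact fun x hx => ?_
      have hx1 : fderiv ℝ (fun y => f y i) x = 0 := by
        by_contra h
        exact hx (support_fderiv_subset ℝ h)
      have hx2 : iteratedFDeriv ℝ 2 (fun y => f y i) x = 0 := by
        by_contra h
        exact hx (support_iteratedFDeriv_subset 2 h)
      simp [hx1, hx2]
    · refine (continuous_const.mul ?_).add ?_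
      · exact continuous_finsetSum _ fun k _ => continuous_finsetSum _ fun l _ =>
          (hC.continuous_a i k l).mul (continuous_second hf' i _)
      · exact continuous_finsetSum _ fun k _ =>
          (hC.continuous_b i k).mul (continuous_first hf' i _)
  choose K₁ hK₁ using h1
  obtain ⟨K₂, hK₂⟩ := hC.exists_abs_integral_jumpIntegrand_le hf
  choose Kq hKq using hC.q_bdd
  obtain ⟨K₀, h₀, hK₀⟩ := hf.exists_abs_le
  refine ⟨∑ i, |K₁ i| + |K₂| + ∑ i, ∑ j, |Kq i j| * K₀, by positivity, fun x i => ?_⟩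
  unfold G
  refine (abs_add_le _ _).trans (add_le_add ((abs_add_le _ _).trans (add_le_add ?_ ?_)) ?_)
  · exact ((hK₁ i x).trans (le_abs_self _)).trans
      (Finset.single_le_sum (f := fun i => |K₁ i|) (fun _ _ => abs_nonneg _) (Finset.mem_univ i))
  · exact (hK₂ x i).trans (le_abs_self _)
  · refine le_trans ?_ (Finset.single_le_sum (f := fun i => ∑ j, |Kq i j| * K₀)
      (fun _ _ => by positivity) (Finset.mem_univ i))
    refine (Finset.abs_sum_le_sum_abs _ _).trans (Finset.sum_le_sum fun j _ => ?_)
    rw [abs_mul]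
    exact mul_le_mul ((hKq i j x).trans (le_abs_self _)) (hK₀ x j) (abs_nonneg _) (abs_nonneg _)

end Coeffs

theorem hasDerivAt_max_zero_pow (n : ℕ) (y : ℝ) :
    HasDerivAt (fun y : ℝ => (max y 0) ^ (n + 2)) ((n + 2) * (max y 0) ^ (n + 1)) y := by
  rcases lt_trichotomy y 0 with hy | rfl | hy
  · have : (fun y : ℝ => (max y 0) ^ (n + 2)) =ᶠ[𝓝 y] fun _ => 0 := by
      filter_upwards [gt_mem_nhds hy] with t ht
      simp [max_eq_right ht.le]
    simpa [max_eq_right hy.le] using (hasDerivAt_const y (0 : ℝ)).congr_of_eventuallyEq this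
  · rw [hasDerivAt_iff_tendsto_slope]
    have h : Tendsto (fun t : ℝ => (max t 0) ^ (n + 1)) (𝓝[≠] 0) (𝓝 ((max 0 0) ^ (n + 1))) :=
      ((by fun_prop : Continuous fun t : ℝ => (max t 0) ^ (n + 1)).tendsto 0).mono_left
        nhdsWithin_le_nhds
    have e : ((n : ℝ) + 2) * (max 0 0) ^ (n + 1) = (max 0 0 : ℝ) ^ (n + 1) := by simp
    rw [e]
    refine h.congr' ?_
    filter_upwards [self_mem_nhdsWithin] with t ht
    have ht' : t ≠ 0 := ht
    rcases le_total t 0 with h0 | h0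
    · simp [slope_def_field, max_eq_right h0]
    · simp only [slope_def_field, max_eq_left h0, max_self, sub_zero]
      field_simp
      simp only [ne_eq, Nat.add_eq_zero_iff, OfNat.ofNat_ne_zero, and_false, not_false_eq_true,
        zero_pow, sub_zero]
      ring
  · have : (fun y : ℝ => (max y 0) ^ (n + 2)) =ᶠ[𝓝 y] fun y => y ^ (n + 2) := by
      filter_upwards [lt_mem_nhds hy] with t ht
      simp [max_eq_left ht.le]
    have h2 := (hasDerivAt_pow (n + 2) y).congr_of_eventuallyEq this
    simpa [max_eq_left hy.le] using h2

theorem hasDerivAt_cube (y : ℝ) :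
    HasDerivAt (fun y : ℝ => (max y 0) ^ 3) (3 * (max y 0) ^ 2) y := by
  have := hasDerivAt_max_zero_pow 1 y
  norm_num at this
  exact this

theorem hasDerivAt_sq (y : ℝ) :
    HasDerivAt (fun y : ℝ => (max y 0) ^ 2) (2 * max y 0) y := by
  have := hasDerivAt_max_zero_pow 0 y
  norm_num at this
  exact this

theorem contDiff_cube : ContDiff ℝ 2 fun y : ℝ => (max y 0) ^ 3 := by
  rw [show (2 : WithTop ℕ∞) = 1 + 1 by norm_num, contDiff_succ_iff_deriv]
  refine ⟨fun y => (hasDerivAt_cube y).differentiableAt, by simp, ?_⟩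
  rw [funext fun y => (hasDerivAt_cube y).deriv, contDiff_one_iff_deriv]
  refine ⟨fun y => ((hasDerivAt_sq y).const_mul 3).differentiableAt, ?_⟩
  have h : (deriv fun y : ℝ => 3 * (max y 0) ^ 2) = fun y => 3 * (2 * max y 0) :=
    funext fun y => ((hasDerivAt_sq y).const_mul 3).deriv
  rw [h]
  fun_prop

theorem cube_convex (p q : ℝ) :
    3 * (max q 0) ^ 2 * (p - q) ≤ (max p 0) ^ 3 - (max q 0) ^ 3 := by
  rcases le_total q 0 with hq | hq
  · simp only [max_eq_right hq]
    have : 0 ≤ (max p 0) ^ 3 := by positivity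
    nlinarith
  · rw [max_eq_left hq]
    have h0 : 0 ≤ max p 0 := le_max_right _ _
    have h1 : p ≤ max p 0 := le_max_left _ _
    have h2 : 3 * q ^ 2 * (p - q) ≤ 3 * q ^ 2 * (max p 0 - q) := by gcongr
    nlinarith [mul_nonneg (by linarith : 0 ≤ max p 0 + 2 * q) (sq_nonneg (max p 0 - q))]

namespace Coeffs

variable {d m : ℕ} {C : Coeffs d m} {V : Rd d → Fin m → ℝ}

theorem a_quadratic_nonneg (C : Coeffs d m) (x : Rd d) (i : Fin m) (ξ : Fin d → ℝ) :
    0 ≤ ∑ k, ∑ l, C.a x i k l * (ξ k * ξ l) := by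
  have h : ∑ k, ∑ l, C.a x i k l * (ξ k * ξ l) = ∑ j, (∑ k, C.σ x i k j * ξ k) ^ 2 := by
    simp_rw [a, Matrix.mul_apply, Matrix.transpose_apply, sq, Finset.sum_mul, Finset.mul_sum]
    rw [Finset.sum_congr rfl fun k _ => Finset.sum_comm, Finset.sum_comm]
    refine Finset.sum_congr rfl fun j _ => Finset.sum_congr rfl fun k _ =>
      Finset.sum_congr rfl fun l _ => by ring
  rw [h]
  positivity

theorem hasFDerivAt_cube_sub (hV : ∀ i, ContDiff ℝ 2 fun y => V y i) (k : ℝ) (x : Rd d)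
    (i : Fin m) : HasFDerivAt (fun y => (max (k - V y i) 0) ^ 3)
      (-(3 * (max (k - V x i) 0) ^ 2) • fderiv ℝ (fun y => V y i) x) x := by
  have h := ((hV i).differentiable (by norm_num) x).hasFDerivAt.const_sub k
  have h' := (hasDerivAt_cube (k - V x i)).comp_hasFDerivAt x h
  rw [smul_neg, ← neg_smul] at h'
  exact h'

theorem iteratedFDeriv_cube_sub (hV : ∀ i, ContDiff ℝ 2 fun y => V y i) (k : ℝ) (x : Rd d)
    (i : Fin m) (v w : Rd d) :
    iteratedFDeriv ℝ 2 (fun y => (max (k - V y i) 0) ^ 3) x ![v, w] =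
      -(3 * (max (k - V x i) 0) ^ 2) * iteratedFDeriv ℝ 2 (fun y => V y i) x ![v, w] +
      6 * max (k - V x i) 0 *
        (fderiv ℝ (fun y => V y i) x v * fderiv ℝ (fun y => V y i) x w) := by
  have h := ((hV i).differentiable (by norm_num) x).hasFDerivAt.const_sub k
  have h1 := ((((hasDerivAt_sq (k - V x i)).const_mul 3).fun_neg).comp_hasFDerivAt x h)
  have h2 : HasFDerivAt (fderiv ℝ fun y => V y i)
      (fderiv ℝ (fderiv ℝ fun y => V y i) x) x :=
    (((hV i).fderiv_right (m := 1) (by norm_num)).differentiable (by norm_num) x).hasFDerivAt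
  have h3 := h1.smul h2
  rw [iteratedFDeriv_two_apply, iteratedFDeriv_two_apply,
    funext fun y => (hasFDerivAt_cube_sub hV k y i).fderiv]
  have h4 := h3.fderiv
  simp only [Function.comp_def] at h4
  change (fderiv ℝ (fun y => -(3 * (max (k - V y i) 0) ^ 2) • fderiv ℝ (fun y => V y i) y) x) _ _ = _
  erw [h4]
  simp
  ring

theorem Assumptions.G_cube_sub_nonneg (hC : C.Assumptions)
    (hV : ∀ i, ContDiff ℝ 2 fun y => V y i) (k : ℝ) (x : Rd d) (i : Fin m)
    (hJ : Integrable (jumpIntegrand V x i) (C.π x i)) (hG : C.G V x i ≤ 0)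
    (hg : IsCc2 fun (y : Rd d) (j : Fin m) => (max (k - V y j) 0) ^ 3) :
    0 ≤ C.G (fun y j => (max (k - V y j) 0) ^ 3) x i := by
  set g : Rd d → Fin m → ℝ := fun y j => (max (k - V y j) 0) ^ 3 with hgdef
  set s := max (k - V x i) 0 with hs
  have hs0 : 0 ≤ s := le_max_right _ _
  have hjump : -(3 * s ^ 2) * ∫ z, jumpIntegrand V x i z ∂(C.π x i) ≤
      ∫ z, jumpIntegrand g x i z ∂(C.π x i) := by
    rw [← integral_const_mul]
    refine integral_mono (hJ.const_mul _) (hC.integrable_jumpIntegrand hg x i) fun z => ?_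
    have h1 := cube_convex (k - V (x + z) i) (k - V x i)
    rw [← hs] at h1
    have h2 : fderiv ℝ (fun y => g y i) x = -(3 * s ^ 2) • fderiv ℝ (fun y => V y i) x :=
      (hasFDerivAt_cube_sub hV k x i).fderiv
    simp only [jumpIntegrand, h2]
    simp only [hgdef, ← hs]
    split_ifs
    · simp only [_root_.smul_apply, smul_eq_mul]
      linarith
    · linarith
  have hq : -(3 * s ^ 2) * ∑ j, C.q x i j * V x j ≤ ∑ j, C.q x i j * g x j := by
    have e1 : ∀ F : Rd d → Fin m → ℝ, ∑ j, C.q x i j * F x j =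
        ∑ j, C.q x i j * (F x j - F x i) := by
      intro F
      simp_rw [mul_sub, Finset.sum_sub_distrib, ← Finset.sum_mul, hC.q_rowsum x i]
      simp
    rw [e1 V, e1 g, Finset.mul_sum]
    refine Finset.sum_le_sum fun j _ => ?_
    rcases eq_or_ne i j with rfl | hij
    · simp
    · have h1 := cube_convex (k - V x j) (k - V x i)
      rw [← hs] at h1
      have := mul_le_mul_of_nonneg_left h1 (hC.q_nonneg x i j hij)
      simp only [hgdef, ← hs]
      linarith
  have hb : ∑ l, C.b x i l * fderiv ℝ (fun y => g y i) x (EuclideanSpace.single l (1 : ℝ)) =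
      -(3 * s ^ 2) * ∑ l, C.b x i l * fderiv ℝ (fun y => V y i) x
        (EuclideanSpace.single l (1 : ℝ)) := by
    rw [Finset.mul_sum]
    refine Finset.sum_congr rfl fun l _ => ?_
    rw [(hasFDerivAt_cube_sub hV k x i).fderiv]
    simp only [_root_.smul_apply, smul_eq_mul, ← hs]
    ring
  have ha : -(3 * s ^ 2) * ∑ l, ∑ l', C.a x i l l' * iteratedFDeriv ℝ 2 (fun y => V y i) x
        ![EuclideanSpace.single l (1 : ℝ), EuclideanSpace.single l' (1 : ℝ)] ≤
      ∑ l, ∑ l', C.a x i l l' * iteratedFDeriv ℝ 2 (fun y => g y i) x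
        ![EuclideanSpace.single l (1 : ℝ), EuclideanSpace.single l' (1 : ℝ)] := by
    have h := mul_nonneg (mul_nonneg (by norm_num : (0 : ℝ) ≤ 6) hs0)
      (a_quadratic_nonneg C x i
        fun l => fderiv ℝ (fun y => V y i) x (EuclideanSpace.single l (1 : ℝ)))
    rw [← sub_nonneg]
    refine h.trans_eq (Eq.symm ?_)
    simp_rw [Finset.mul_sum, ← Finset.sum_sub_distrib]
    refine Finset.sum_congr rfl fun l _ => Finset.sum_congr rfl fun l' _ => ?_
    rw [iteratedFDeriv_cube_sub hV k x i]
    ring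
  have hneg : 0 ≤ -(3 * s ^ 2) * C.G V x i :=
    mul_nonneg_of_nonpos_of_nonpos (by nlinarith [sq_nonneg s]) hG
  unfold G at hneg ⊢
  rw [hb]
  linarith

theorem isCc2_cube_sub (hV : ∀ i, ContDiff ℝ 2 fun y => V y i) {k r : ℝ}
    (hr : ∀ x i, r ≤ ‖x‖ → k ≤ V x i) :
    IsCc2 fun (y : Rd d) (j : Fin m) => (max (k - V y j) 0) ^ 3 := by
  refine fun i => ⟨contDiff_cube.comp (contDiff_const.sub (hV i)),
    HasCompactSupport.intro (isCompact_closedBall 0 r) fun x hx => ?_⟩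
  rw [mem_closedBall_zero_iff, not_le] at hx
  simp [hr x i hx.le]

theorem Assumptions.exists_G_ge (hC : C.Assumptions) (hd : 1 ≤ d) (r : ℝ) (hr : 0 ≤ r) :
    ∃ f : Rd d → Fin m → ℝ, IsCc2 f ∧ (∀ x i, 0 ≤ f x i) ∧
      ∃ c > 0, ∀ x i, ‖x‖ ≤ r → c ≤ C.G f x i := by
  obtain ⟨K, hK⟩ := hC.large_jumps
  obtain ⟨c, hc, hgr⟩ := hC.growth
  obtain ⟨κ, hκ, hell⟩ := hC.elliptic (ball 0 (r + 1))
    ⟨isOpen_ball, ⟨⟨0, by simp; linarith⟩, (convex_ball _ _).isPreconnected⟩, isBounded_ball⟩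
  have hκ0 : 0 < κ := hκ.1
  let e : Fin d := ⟨0, hd⟩
  let χ : ContDiffBump (0 : Rd d) := ⟨r + 2, r + 3, by linarith, by linarith⟩
  let pr : Rd d →L[ℝ] ℝ := EuclideanSpace.proj e
  have hpr : ∀ x : Rd d, pr x = x e := fun _ => rfl
  obtain ⟨lam, hl0, hl⟩ : ∃ lam : ℝ, 0 < lam ∧
      1 ≤ 1 / 2 * (lam ^ 2 * κ) - lam * (c * (1 + r)) - K := by
    set B := c * (1 + r) with hB
    have hB0 : 0 ≤ B := by positivity
    have hK0 : (0 : ℝ) ≤ K := K.coe_nonneg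
    refine ⟨2 * (B + K + 1) / κ + 1, by positivity, ?_⟩
    set lam := 2 * (B + K + 1) / κ + 1 with hlam
    have h1 : 1 ≤ lam := by rw [hlam]; linarith [show 0 ≤ 2 * (B + K + 1) / κ by positivity]
    have h2 : 2 * (B + K + 1) ≤ lam * κ := by
      rw [hlam, add_mul, div_mul_cancel₀ _ hκ0.ne']
      linarith
    nlinarith
  set E : Rd d → ℝ := fun x => Real.exp (lam * pr x) with hE
  have hEc : ContDiff ℝ 2 E := Real.contDiff_exp.comp (contDiff_const.mul pr.contDiff)
  set f : Rd d → Fin m → ℝ := fun x _ => χ x * E x with hfdef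
  have hf : IsCc2 f := fun i => ⟨χ.contDiff.mul hEc, χ.hasCompactSupport.mul_right⟩
  have hf0 : ∀ x i, 0 ≤ f x i := fun x i => mul_nonneg χ.nonneg (Real.exp_pos _).le
  have hfE : ∀ x i, ‖x‖ ≤ r + 2 → f x i = E x := by
    intro x i hx
    simp [hfdef, χ.one_of_mem_closedBall (mem_closedBall_zero_iff.2 hx)]
  have hfE' : ∀ x i, ‖x‖ < r + 2 → (fun y => f y i) =ᶠ[𝓝 x] E := by
    intro x i hx
    filter_upwards [isOpen_ball.mem_nhds (mem_ball_zero_iff.2 hx)] with y hy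
    exact hfE y i (mem_ball_zero_iff.1 hy).le
  have hE1 : ∀ x, HasFDerivAt E ((lam * E x) • pr) x := by
    intro x
    have := (pr.hasFDerivAt (x := x)).const_mul lam |>.exp
    rw [smul_smul, mul_comm] at this
    exact this
  have hE2 : ∀ x v w, fderiv ℝ (fderiv ℝ E) x v w = lam ^ 2 * E x * (pr v * pr w) := by
    intro x v w
    rw [funext fun y => (hE1 y).fderiv]
    have h := (((hE1 x).const_mul lam).smul_const pr).fderiv
    rw [h]
    simp
    ring
  refine ⟨f, hf, hf0, Real.exp (-(lam * r)), Real.exp_pos _, fun x i hx => ?_⟩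
  have hx2 : ‖x‖ < r + 2 := by linarith
  have hEx : 0 < E x := Real.exp_pos _
  have hfx := hfE x i hx2.le
  have hfd : fderiv ℝ (fun y => f y i) x = (lam * E x) • pr :=
    (hfE' x i hx2).fderiv_eq.trans (hE1 x).fderiv
  have hfd2 : ∀ v w, iteratedFDeriv ℝ 2 (fun y => f y i) x ![v, w] =
      lam ^ 2 * E x * (pr v * pr w) := by
    intro v w
    rw [iteratedFDeriv_two_apply, ← hE2]
    simp [(hfE' x i hx2).fderiv.fderiv_eq]
  have hprs : ∀ k : Fin d, pr (EuclideanSpace.single k (1 : ℝ)) = if k = e then 1 else 0 := by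
    intro k
    rw [hpr]
    simp [eq_comm]
  have ha : κ ≤ C.a x i e e := by
    have h := (hell (EuclideanSpace.single e 1) x (mem_ball_zero_iff.2 (by linarith)) i).1
    simpa [Pi.single_apply] using h
  have hb : -(c * (1 + r)) ≤ C.b x i e := by
    have h1 : |C.b x i e| ≤ ∑ k, |C.b x i k| :=
      Finset.single_le_sum (f := fun k => |C.b x i k|) (fun _ _ => abs_nonneg _)
        (Finset.mem_univ e)
    have h2 : 0 ≤ ∑ k, ∑ l, |C.σ x i k l| := by positivity
    have h3 : c * (1 + ‖x‖) ≤ c * (1 + r) := by gcongr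
    have h4 := neg_abs_le (C.b x i e)
    linarith [hgr x i]
  have hfin : C.π x i (ball (0 : Rd d) 1)ᶜ < ⊤ := (hK x i).trans_lt ENNReal.coe_lt_top
  have hJ : -(E x * K) ≤ ∫ z, jumpIntegrand f x i z ∂(C.π x i) := by
    have h1 : ∫ z, (ball (0 : Rd d) 1)ᶜ.indicator (fun _ => -E x) z ∂(C.π x i) ≤
        ∫ z, jumpIntegrand f x i z ∂(C.π x i) := by
      refine integral_mono ((integrable_indicator_iff measurableSet_ball.compl).2
        (integrableOn_const hfin.ne)) (hC.integrable_jumpIntegrand hf x i) fun z => ?_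
      unfold jumpIntegrand
      by_cases hz : ‖z‖ < 1
      · have hxz : ‖x + z‖ ≤ r + 2 := (norm_add_le _ _).trans (by linarith)
        simp only [mem_compl_iff, mem_ball_zero_iff, hz, not_true, not_false_eq_true,
          indicator_of_notMem, if_true, hfd, hfx, hfE _ i hxz]
        have h2 := Real.add_one_le_exp (lam * pr z)
        have h3 : E (x + z) = E x * Real.exp (lam * pr z) := by
          simp [hE, mul_add, Real.exp_add]
        rw [h3]
        simp only [_root_.smul_apply, smul_eq_mul]
        nlinarith
      · have hz' : z ∈ (ball (0 : Rd d) 1)ᶜ := by simpa using hz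
        rw [indicator_of_mem hz', if_neg hz, hfx]
        linarith [hf0 (x + z) i]
    rw [integral_indicator measurableSet_ball.compl, setIntegral_const] at h1
    have h2 : (C.π x i).real (ball (0 : Rd d) 1)ᶜ ≤ K :=
      ENNReal.toReal_le_coe_of_le_coe (hK x i)
    rw [smul_eq_mul] at h1
    nlinarith
  have hq : ∑ j, C.q x i j * f x j = 0 := by
    simp only [hfdef, ← Finset.sum_mul, hC.q_rowsum x i, zero_mul]
  have hA : ∑ k, ∑ l, C.a x i k l * iteratedFDeriv ℝ 2 (fun y => f y i) x
        ![EuclideanSpace.single k (1 : ℝ), EuclideanSpace.single l (1 : ℝ)] =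
      C.a x i e e * (lam ^ 2 * E x) := by
    simp [hfd2, hprs]
  have hB : ∑ k, C.b x i k * fderiv ℝ (fun y => f y i) x (EuclideanSpace.single k (1 : ℝ)) =
      C.b x i e * (lam * E x) := by
    simp [hfd, hprs]
  have hlow : Real.exp (-(lam * r)) ≤ E x := by
    refine Real.exp_le_exp.2 ?_
    have h1 : |pr x| ≤ ‖x‖ := by
      rw [hpr, ← Real.norm_eq_abs]
      exact PiLp.norm_apply_le x e
    have := neg_abs_le (pr x)
    nlinarith
  unfold G
  rw [hA, hB, hq]
  have h1 : κ * (lam ^ 2 * E x) ≤ C.a x i e e * (lam ^ 2 * E x) := by gcongr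
  have h2 : -(c * (1 + r)) * (lam * E x) ≤ C.b x i e * (lam * E x) := by gcongr
  nlinarith [mul_le_mul_of_nonneg_right hl hEx.le]

end Coeffs

namespace PathSpace

variable {d m : ℕ}

theorem measurable_path (w : PathSpace d m) : Measurable fun s : ℝ≥0 => Z s w := by
  have hlim : ∀ s : ℝ≥0, Tendsto (fun n : ℕ => ((⌊s * (n + 1)⌋₊ + 1 : ℕ) : ℝ≥0) / (n + 1)) atTop
      (𝓝[≥] s) := by
    intro s
    have hlow : ∀ n : ℕ, s ≤ ((⌊s * (n + 1)⌋₊ + 1 : ℕ) : ℝ≥0) / (n + 1) := by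
      intro n
      rw [le_div_iff₀ (by positivity)]
      push_cast
      exact (Nat.lt_floor_add_one _).le
    refine tendsto_nhdsWithin_iff.2 ⟨?_, Eventually.of_forall hlow⟩
    have hup : ∀ n : ℕ, ((⌊s * (n + 1)⌋₊ + 1 : ℕ) : ℝ≥0) / (n + 1) ≤ s + 1 / ((n : ℝ≥0) + 1) := by
      intro n
      rw [div_le_iff₀ (by positivity), add_mul, one_div, inv_mul_cancel₀ (by positivity)]
      push_cast
      gcongr
      exact Nat.floor_le (by positivity)
    refine tendsto_of_tendsto_of_tendsto_of_le_of_le tendsto_const_nhds ?_ hlow hup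
    have h := (tendsto_one_div_add_atTop_nhds_zero_nat (𝕜 := ℝ≥0)).const_add s
    rwa [add_zero] at h
  refine measurable_of_tendsto_metrizable
    (f := fun (n : ℕ) (s : ℝ≥0) => Z (((⌊s * (n + 1)⌋₊ + 1 : ℕ) : ℝ≥0) / (n + 1)) w) ?_ ?_
  · intro n
    have h1 : Measurable fun s : ℝ≥0 => ⌊s * (n + 1)⌋₊ :=
      Nat.measurable_floor.comp (measurable_id.mul_const _)
    exact (measurable_from_nat (f := fun k : ℕ => Z (((k + 1 : ℕ) : ℝ≥0) / (n + 1)) w)).comp h1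
  · rw [tendsto_pi_nhds]
    exact fun s => (w.2.1 s).tendsto.comp (hlim s)

/-- The `k`-th point of the partition of `[0,t]` into `N + 1` equal parts. -/
noncomputable def gridPt (t : ℝ≥0) (N k : ℕ) : ℝ≥0 := k * t / (N + 1)

/-- The index of the first point of the partition at which the path is in `A`, or `N + 1`. -/
noncomputable def gridIdx (A : Set (Rd d × Fin m)) (t : ℝ≥0) (N : ℕ) (w : PathSpace d m) : ℕ :=
  hittingBtwn (fun k => Z (gridPt t N k)) A 0 (N + 1) w

/-- The first point of the partition at which the path is in `A`, or `t`. -/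
noncomputable def gridTime (A : Set (Rd d × Fin m)) (t : ℝ≥0) (N : ℕ) (w : PathSpace d m) : ℝ≥0 :=
  gridPt t N (gridIdx A t N w)

/-- The minimum of `t` and the entrance time of `A`. -/
noncomputable def hitTime (A : Set (Rd d × Fin m)) (t : ℝ≥0) (w : PathSpace d m) : ℝ≥0 :=
  sInf (insert t {s | Z s w ∈ A})

theorem gridPt_mono (t : ℝ≥0) (N : ℕ) : Monotone (gridPt t N) := by
  intro k l h
  unfold gridPt
  gcongr

theorem gridPt_zero (t : ℝ≥0) (N : ℕ) : gridPt t N 0 = 0 := by simp [gridPt]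

theorem gridPt_last (t : ℝ≥0) (N : ℕ) : gridPt t N (N + 1) = t := by
  unfold gridPt
  push_cast
  rw [mul_comm, mul_div_assoc, div_self (by positivity), mul_one]

variable (A : Set (Rd d × Fin m)) (t : ℝ≥0) (N : ℕ) (w : PathSpace d m)

theorem gridIdx_le : gridIdx A t N w ≤ N + 1 := hittingBtwn_le w

theorem gridTime_le : gridTime A t N w ≤ t :=
  (gridPt_mono t N (gridIdx_le A t N w)).trans_eq (gridPt_last t N)

theorem gridTime_eq_or_mem : gridTime A t N w = t ∨ Z (gridTime A t N w) w ∈ A := by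
  rcases (gridIdx_le A t N w).eq_or_lt with h | h
  · left
    rw [gridTime, h, gridPt_last]
  · exact Or.inr (hittingBtwn_mem_set_of_hittingBtwn_lt
      (u := fun k (w : PathSpace d m) => Z (gridPt t N k) w) h)

theorem hitTime_le : hitTime A t w ≤ t := csInf_le (OrderBot.bddBelow _) (mem_insert _ _)

theorem hitTime_le_gridTime : hitTime A t w ≤ gridTime A t N w := by
  rcases gridTime_eq_or_mem A t N w with h | h
  · exact (hitTime_le A t w).trans_eq h.symm
  · exact csInf_le (OrderBot.bddBelow _) (mem_insert_of_mem _ h)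

variable {A t w} in
theorem notMem_of_lt_hitTime {s : ℝ≥0} (hs : s < hitTime A t w) : Z s w ∉ A :=
  fun h => hs.not_ge (csInf_le (OrderBot.bddBelow _) (mem_insert_of_mem _ h))

variable {A} in
theorem tendsto_gridTime (hA : IsOpen A) :
    Tendsto (fun N => gridTime A t N w) atTop (𝓝 (hitTime A t w)) := by
  refine tendsto_order.2 ⟨fun a ha => Eventually.of_forall fun N =>
    ha.trans_le (hitTime_le_gridTime A t N w), fun a ha => ?_⟩
  obtain ⟨s, hs, hsa⟩ := exists_lt_of_csInf_lt (insert_nonempty _ _) ha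
  rcases le_or_gt t s with hts | hst
  · exact Eventually.of_forall fun N => (gridTime_le A t N w).trans_lt (hts.trans_lt hsa)
  have hsA : Z s w ∈ A := by
    rcases hs with rfl | hs
    · exact absurd hst (lt_irrefl _)
    · exact hs
  have hev : ∀ᶠ u in 𝓝[≥] s, Z u w ∈ A := (w.2.1 s) (hA.mem_nhds hsA)
  obtain ⟨u, hu, hsub⟩ := (mem_nhdsGE_iff_exists_Ico_subset' hst).1 hev
  have hsu : s < u := hu
  set b := min u (min a t) with hb
  have hsb : s < b := lt_min hsu (lt_min hsa hst)
  have ht0 : (0 : ℝ) < t := (NNReal.coe_nonneg s).trans_lt (NNReal.coe_lt_coe.2 hst)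
  have hlim : Tendsto (fun N : ℕ => (s : ℝ) + t * (1 / ((N : ℝ) + 1))) atTop
      (𝓝 ((s : ℝ) + t * 0)) :=
    (tendsto_one_div_add_atTop_nhds_zero_nat.const_mul _).const_add _
  rw [mul_zero, add_zero] at hlim
  filter_upwards [hlim.eventually (gt_mem_nhds (NNReal.coe_lt_coe.2 hsb))] with N hN
  set k : ℕ := ⌈(s : ℝ) * (N + 1) / t⌉₊ with hk
  have hN0 : (0 : ℝ) < N + 1 := by positivity
  have hcoe : ((gridPt t N k : ℝ≥0) : ℝ) = k * t / (N + 1) := by simp [gridPt]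
  have h1 : s ≤ gridPt t N k := by
    rw [← NNReal.coe_le_coe, hcoe, le_div_iff₀ hN0, ← div_le_iff₀ ht0]
    exact Nat.le_ceil _
  have h2 : gridPt t N k < b := by
    rw [← NNReal.coe_lt_coe, hcoe]
    refine lt_of_le_of_lt ?_ hN
    have h3 : (k : ℝ) < (s : ℝ) * (N + 1) / t + 1 := Nat.ceil_lt_add_one (by positivity)
    rw [div_le_iff₀ hN0]
    calc (k : ℝ) * t ≤ ((s : ℝ) * (N + 1) / t + 1) * t := by gcongr
      _ = ((s : ℝ) + t * (1 / ((N : ℝ) + 1))) * (N + 1) := by field_simp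
  have hkN : k ≤ N + 1 := by
    by_contra hlt
    have := gridPt_mono t N (not_le.1 hlt).le
    rw [gridPt_last] at this
    exact (this.trans_lt h2).not_ge ((min_le_right _ _).trans (min_le_right _ _))
  have hmem : Z (gridPt t N k) w ∈ A := hsub ⟨h1, h2.trans_le (min_le_left _ _)⟩
  have hidx : gridIdx A t N w ≤ k :=
    hittingBtwn_le_of_mem (u := fun k (w : PathSpace d m) => Z (gridPt t N k) w)
      (Nat.zero_le _) hkN hmem
  exact ((gridPt_mono t N hidx).trans_lt h2).trans_le ((min_le_right _ _).trans (min_le_left _ _))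

/-- The filtration of the process observed at the points of the partition. -/
noncomputable def gridFiltration (d m : ℕ) (t : ℝ≥0) (N : ℕ) :
    Filtration ℕ (inferInstance : MeasurableSpace (PathSpace d m)) where
  seq k := ℱ d m (gridPt t N k)
  mono' _ _ h := (ℱ d m).mono (gridPt_mono t N h)
  le' _ := (ℱ d m).le _

variable {A} in
theorem isStoppingTime_gridIdx (hA : MeasurableSet A) :
    IsStoppingTime (gridFiltration d m t N) fun w => ((gridIdx A t N w : ℕ) : ℕ∞) := by
  refine Adapted.isStoppingTime_hittingBtwn (u := fun k => Z (gridPt t N k)) ?_ hA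
  intro k
  have h := (Filtration.stronglyAdapted_natural (u := (Z : ℝ≥0 → PathSpace d m → Rd d × Fin m))
    (fun t => (measurable_Z t).stronglyMeasurable) (gridPt t N k)).measurable
  exact h.mono (Filtration.le_rightCont _ _) le_rfl

variable {A} in
theorem measurable_gridIdx (hA : MeasurableSet A) :
    Measurable (gridIdx A t N : PathSpace d m → ℕ) := by
  refine measurable_of_Iic fun k => ?_
  have h := (gridFiltration d m t N).le k _ (isStoppingTime_gridIdx t N hA k)
  have e : gridIdx A t N ⁻¹' Iic k =
      {w : PathSpace d m | ((gridIdx A t N w : ℕ) : ℕ∞) ≤ (k : ℕ∞)} := by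
    ext w
    simp
  rw [e]
  exact h

variable {A} in
theorem measurable_gridTime (hA : MeasurableSet A) :
    Measurable (gridTime A t N : PathSpace d m → ℝ≥0) :=
  (measurable_from_nat (f := gridPt t N)).comp (measurable_gridIdx t N hA)

variable {A} in
theorem measurable_Z_gridTime (hA : MeasurableSet A) :
    Measurable fun w : PathSpace d m => Z (gridTime A t N w) w := by
  have h : Measurable fun p : ℕ × PathSpace d m => Z (gridPt t N p.1) p.2 :=
    measurable_from_prod_countable_right fun k => measurable_Z (gridPt t N k)
  exact h.comp ((measurable_gridIdx t N hA).prodMk measurable_id)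

variable {A} in
theorem measurable_hitTime (hA : IsOpen A) :
    Measurable (hitTime A t : PathSpace d m → ℝ≥0) :=
  measurable_of_tendsto_metrizable (fun N => measurable_gridTime t N hA.measurableSet)
    (tendsto_pi_nhds.2 fun w => tendsto_gridTime t w hA)

theorem _root_.MeasureTheory.Martingale.integral_gridTime_nonneg {P : Measure (PathSpace d m)}
    [IsProbabilityMeasure P] {M : ℝ≥0 → PathSpace d m → ℝ} (hM : Martingale M (ℱ d m) P)
    (h0 : ∀ w, M 0 w = 0) {A : Set (Rd d × Fin m)} (hA : MeasurableSet A) (t : ℝ≥0) (N : ℕ) :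
    Integrable (fun w => M (gridTime A t N w) w) P ∧
      0 ≤ ∫ w, M (gridTime A t N w) w ∂P := by
  have hM' : Martingale (fun k => M (gridPt t N k)) (gridFiltration d m t N) P :=
    ⟨fun k => hM.1 _, fun k l h => hM.2 _ _ (gridPt_mono t N h)⟩
  have hτ := isStoppingTime_gridIdx t N hA
  have hb : ∀ w, ((gridIdx A t N w : ℕ) : ℕ∞) ≤ ((N + 1 : ℕ) : ℕ∞) :=
    fun w => Nat.cast_le.2 (gridIdx_le A t N w)
  have e : stoppedValue (fun k => M (gridPt t N k)) (fun w => ((gridIdx A t N w : ℕ) : ℕ∞)) =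
      fun w => M (gridTime A t N w) w := by
    funext w
    rfl
  have e0 : stoppedValue (fun k => M (gridPt t N k)) (fun _ => ((0 : ℕ) : ℕ∞)) = fun _ => 0 := by
    funext w
    change M (gridPt t N 0) w = 0
    rw [gridPt_zero, h0]
  have hint := hM'.submartingale.integrable_stoppedValue hτ hb
  have h := hM'.submartingale.expected_stoppedValue_mono
    (isStoppingTime_const (gridFiltration d m t N) 0) hτ (fun w => zero_le) hb
  rw [e] at hint h
  refine ⟨hint, ?_⟩
  have e1 : ∫ w, stoppedValue (fun k => M (gridPt t N k)) (fun _ => ((0 : ℕ) : ℕ∞)) w ∂P = 0 := by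
    rw [e0, integral_zero]
  exact e1.ge.trans h

end PathSpace

variable {d m : ℕ}

namespace PathSpace

theorem measurable_along_path {φ : Rd d → Fin m → ℝ} (hφ : ∀ i, Measurable fun x => φ x i)
    (w : PathSpace d m) : Measurable fun s : ℝ => φ (X s.toNNReal w) (Λ s.toNNReal w) := by
  have h : Measurable fun p : Rd d × Fin m => φ p.1 p.2 :=
    measurable_from_prod_countable_left hφ
  exact h.comp ((measurable_path w).comp measurable_real_toNNReal)

theorem le_integral_along_path {φ : Rd d → Fin m → ℝ} (hφ : ∀ i, Measurable fun x => φ x i)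
    {K c : ℝ} (hK : ∀ x i, |φ x i| ≤ K) {A : Set (Rd d × Fin m)}
    (hc : ∀ x i, (x, i) ∉ A → c ≤ φ x i) (w : PathSpace d m) (t : ℝ≥0) (N : ℕ) :
    c * (hitTime A t w : ℝ) - K * ((gridTime A t N w : ℝ) - (hitTime A t w : ℝ)) ≤
      ∫ s in (0 : ℝ)..gridTime A t N w, φ (X s.toNNReal w) (Λ s.toNNReal w) := by
  set T : ℝ := (hitTime A t w : ℝ) with hT
  set S : ℝ := (gridTime A t N w : ℝ) with hS
  have hT0 : 0 ≤ T := NNReal.coe_nonneg _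
  have hTS : T ≤ S := NNReal.coe_le_coe.2 (hitTime_le_gridTime A t N w)
  have hint : ∀ a b : ℝ, IntervalIntegrable
      (fun s : ℝ => φ (X s.toNNReal w) (Λ s.toNNReal w)) volume a b := fun a b =>
    (intervalIntegrable_const (c := K)).mono_fun
      (measurable_along_path hφ w).aestronglyMeasurable
      (ae_of_all _ fun s => (hK _ _).trans (le_abs_self K))
  rw [← intervalIntegral.integral_add_adjacent_intervals (hint 0 T) (hint T S)]
  have h1 : ∫ _ in (0 : ℝ)..T, c ≤ ∫ s in (0 : ℝ)..T, φ (X s.toNNReal w) (Λ s.toNNReal w) := by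
    refine intervalIntegral.integral_mono_on_of_le_Ioo hT0 intervalIntegrable_const (hint 0 T)
      fun s hs => hc _ _ ?_
    refine notMem_of_lt_hitTime (A := A) (t := t) (w := w) ?_
    rw [← NNReal.coe_lt_coe, Real.coe_toNNReal _ hs.1.le]
    exact hs.2
  have h2 : ∫ _ in T..S, -K ≤ ∫ s in T..S, φ (X s.toNNReal w) (Λ s.toNNReal w) :=
    intervalIntegral.integral_mono_on hTS intervalIntegrable_const (hint T S)
      fun s _ => (abs_le.1 (hK _ _)).1
  rw [intervalIntegral.integral_const, smul_eq_mul] at h1 h2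
  linarith

theorem integrable_time {P : Measure (PathSpace d m)} [IsProbabilityMeasure P]
    {T : PathSpace d m → ℝ≥0} (hT : Measurable T) {t : ℝ≥0} (h : ∀ w, T w ≤ t) :
    Integrable (fun w => (T w : ℝ)) P :=
  (integrable_const (t : ℝ)).mono' (measurable_coe_nnreal_real.comp hT).aestronglyMeasurable
    (ae_of_all _ fun w => by simpa using h w)

theorem integrable_gridTime (P : Measure (PathSpace d m)) [IsProbabilityMeasure P]
    {A : Set (Rd d × Fin m)} (hA : IsOpen A) (t : ℝ≥0) (N : ℕ) :
    Integrable (fun w => (gridTime A t N w : ℝ)) P :=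
  integrable_time (measurable_gridTime t N hA.measurableSet) (gridTime_le A t N)

theorem integrable_hitTime (P : Measure (PathSpace d m)) [IsProbabilityMeasure P]
    {A : Set (Rd d × Fin m)} (hA : IsOpen A) (t : ℝ≥0) :
    Integrable (fun w => (hitTime A t w : ℝ)) P :=
  integrable_time (measurable_hitTime t hA) (hitTime_le A t)

theorem tendsto_integral_gridTime (P : Measure (PathSpace d m)) [IsProbabilityMeasure P]
    {A : Set (Rd d × Fin m)} (hA : IsOpen A) (t : ℝ≥0) :
    Tendsto (fun N => ∫ w, (gridTime A t N w : ℝ) ∂P) atTop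
      (𝓝 (∫ w, (hitTime A t w : ℝ) ∂P)) := by
  refine tendsto_integral_of_dominated_convergence (fun _ => (t : ℝ))
    (fun N => (integrable_gridTime P hA t N).aestronglyMeasurable) (integrable_const _)
    (fun N => ae_of_all _ fun w => by simpa using gridTime_le A t N w)
    (ae_of_all _ fun w => ?_)
  exact (NNReal.continuous_coe.tendsto _).comp (tendsto_gridTime t w hA)

end PathSpace

open PathSpace

theorem IsCc2.integrable_gridTime {f : Rd d → Fin m → ℝ} (hf : IsCc2 f)
    (P : Measure (PathSpace d m)) [IsProbabilityMeasure P]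
    {A : Set (Rd d × Fin m)} (hA : IsOpen A) (t : ℝ≥0) (N : ℕ) :
    Integrable (fun w => f (X (gridTime A t N w) w) (Λ (gridTime A t N w) w)) P := by
  obtain ⟨K, _, hK⟩ := hf.exists_abs_le
  have h : Measurable fun p : Rd d × Fin m => f p.1 p.2 :=
    measurable_from_prod_countable_left fun i => (hf i).1.continuous.measurable
  exact (integrable_const K).mono'
    (h.comp (measurable_Z_gridTime t N hA.measurableSet)).aestronglyMeasurable
    (ae_of_all _ fun w => hK _ _)

/-- Dynkin's inequality up to the discretized entrance time of `A`. -/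
theorem SolvesMP.le_integral_gridTime {C : Coeffs d m} (hC : C.Assumptions) {x : Rd d} {i : Fin m}
    {P : Measure (PathSpace d m)} (hP : SolvesMP C x i P) {f : Rd d → Fin m → ℝ} (hf : IsCc2 f)
    {K c : ℝ} (hK : ∀ x i, |C.G f x i| ≤ K) {A : Set (Rd d × Fin m)} (hA : IsOpen A)
    (hc : ∀ x i, (x, i) ∉ A → c ≤ C.G f x i) (t : ℝ≥0) (N : ℕ) :
    f x i + c * ∫ w, (hitTime A t w : ℝ) ∂P -
        K * (∫ w, (gridTime A t N w : ℝ) ∂P - ∫ w, (hitTime A t w : ℝ) ∂P) ≤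
      ∫ w, f (X (gridTime A t N w) w) (Λ (gridTime A t N w) w) ∂P := by
  have := hP.prob
  obtain ⟨hMi, hM⟩ := (hP.mart f hf.isCb2).integral_gridTime_nonneg (by simp) hA.measurableSet t N
  have hinit : ∀ᵐ w ∂P, X 0 w = x ∧ Λ 0 w = i := by
    have hms : MeasurableSet {w : PathSpace d m | X 0 w = x ∧ Λ 0 w = i} := by
      have : {w : PathSpace d m | X 0 w = x ∧ Λ 0 w = i} = Z 0 ⁻¹' {(x, i)} := by
        ext w
        simp [X, Λ, Prod.ext_iff]
      rw [this]
      exact measurable_Z 0 (measurableSet_singleton _)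
    exact (prob_compl_eq_zero_iff hms).2 hP.init
  have hT := integrable_hitTime P hA t
  have hS := integrable_gridTime P hA t N
  have hfi := hf.integrable_gridTime P hA t N
  have hle := integral_mono_ae hMi
    (hfi.sub (((integrable_const (f x i)).add (hT.const_mul c)).sub
      ((hS.sub hT).const_mul K))) (by
        filter_upwards [hinit] with w hw
        have h := le_integral_along_path (hC.measurable_G fun i => (hf i).1) hK hc w t N
        simp only [hw.1, hw.2, Pi.sub_apply, Pi.add_apply]
        linarith)
  rw [integral_sub' hfi (((integrable_const (f x i)).add (hT.const_mul c)).sub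
      ((hS.sub hT).const_mul K)), integral_sub' ((integrable_const (f x i)).add (hT.const_mul c))
      ((hS.sub hT).const_mul K), integral_add' (integrable_const (f x i)) (hT.const_mul c),
    integral_const_mul, integral_const_mul, integral_sub' hS hT] at hle
  simp only [integral_const, probReal_univ, one_smul] at hle
  linarith

/-- The event that the path is in `D` at one of the points of the partitions of the
intervals `[0, n]`. -/
def gridHits (m : ℕ) (D : Set (Rd d)) : Set (PathSpace d m) :=
  ⋃ (n : ℕ) (N : ℕ) (k : ℕ), {w | X (gridPt n N k) w ∈ D}

theorem measurableSet_gridHits {D : Set (Rd d)} (hD : IsOpen D) :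
    MeasurableSet (gridHits m D) :=
  MeasurableSet.iUnion fun _ => MeasurableSet.iUnion fun _ => MeasurableSet.iUnion fun _ =>
    (measurable_fst.comp (measurable_Z _)) hD.measurableSet

theorem gridHits_subset (D : Set (Rd d)) :
    gridHits m D ⊆ {w | entrance (D ×ˢ (univ : Set (Fin m))) w < ⊤} := by
  intro w hw
  simp only [gridHits, mem_iUnion] at hw
  obtain ⟨n, N, k, h⟩ := hw
  have hU : Z (gridPt n N k) w ∈ D ×ˢ (univ : Set (Fin m)) := ⟨h, mem_univ _⟩
  have hle : entrance (D ×ˢ (univ : Set (Fin m))) w ≤ (gridPt n N k : ℝ≥0∞) :=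
    iInf₂_le (gridPt n N k) hU
  exact hle.trans_lt ENNReal.coe_lt_top

theorem SolvesMP.le_measure_gridHits {C : Coeffs d m} (hC : C.Assumptions) (hd : 1 ≤ d)
    {x : Rd d} {i : Fin m} {P : Measure (PathSpace d m)} (hP : SolvesMP C x i P)
    {D : Set (Rd d)} (hD : IsOpen D) {g : Rd d → Fin m → ℝ} (hg : IsCc2 g) {B r : ℝ}
    (hr0 : 0 ≤ r) (hB : 0 ≤ B) (hgB : ∀ x i, g x i ≤ B) (hgr : ∀ x i, r < ‖x‖ → g x i ≤ 0)
    (hGg : ∀ x ∉ D, ∀ i, 0 ≤ C.G g x i) :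
    g x i ≤ B * P.real (gridHits m D) := by
  have := hP.prob
  obtain ⟨f, hf, hf0, c, hc, hGf⟩ := hC.exists_G_ge hd r hr0
  obtain ⟨F, hF0, hF⟩ := hf.exists_abs_le
  obtain ⟨Kf, -, hKf⟩ := hC.exists_abs_G_le hf
  obtain ⟨Kg, -, hKg⟩ := hC.exists_abs_G_le hg
  set A : Set (Rd d × Fin m) := (D ∪ (closedBall 0 r)ᶜ) ×ˢ univ with hAdef
  have hA : IsOpen A := (hD.union isClosed_closedBall.isOpen_compl).prod isOpen_univ
  have hnot : ∀ (y : Rd d) (j : Fin m), (y, j) ∉ A → y ∉ D ∧ ‖y‖ ≤ r := by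
    intro y j h
    simpa [hAdef, not_or] using h
  have hSm := measurableSet_gridHits (m := m) hD
  have key : ∀ n : ℕ, g x i ≤ B * (P.real (gridHits m D) + F / c * (1 / ((n : ℝ) + 1))) := by
    intro n
    set t : ℝ≥0 := ((n + 1 : ℕ) : ℝ≥0) with ht
    have ht' : (t : ℝ) = n + 1 := by simp [ht]
    have ht0 : (0 : ℝ) < t := by rw [ht']; positivity
    set ET := ∫ w, (hitTime A t w : ℝ) ∂P with hET
    have hlim := tendsto_integral_gridTime P hA t
    have hETle : ET ≤ F / c := by
      rw [le_div_iff₀ hc]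
      have h1 : ∀ N, f x i + c * ET - Kf * (∫ w, (gridTime A t N w : ℝ) ∂P - ET) ≤ F := by
        intro N
        refine (hP.le_integral_gridTime hC hf hKf hA
          (fun y j h => hGf y j (hnot y j h).2) t N).trans ?_
        refine (integral_mono (hf.integrable_gridTime P hA t N) (integrable_const F)
          fun w => (le_abs_self _).trans (hF _ _)).trans_eq ?_
        simp
      have h2 : f x i + c * ET - Kf * (ET - ET) ≤ F :=
        le_of_tendsto (((hlim.sub_const ET).const_mul Kf).const_sub _) (Eventually.of_forall h1)
      rw [sub_self, mul_zero, sub_zero] at h2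
      linarith [hf0 x i]
    have hgN : ∀ N, g x i + 0 * ET - Kg * (∫ w, (gridTime A t N w : ℝ) ∂P - ET) ≤
        B * (P.real (gridHits m D) + (∫ w, (gridTime A t N w : ℝ) ∂P) / t) := by
      intro N
      refine (hP.le_integral_gridTime hC hg hKg hA
        (fun y j h => hGg y (hnot y j h).1 j) t N).trans ?_
      have hi1 : Integrable ((gridHits m D).indicator fun _ => (1 : ℝ)) P :=
        (integrable_const _).indicator hSm
      have hi2 := (integrable_gridTime P hA t N).div_const (t : ℝ)
      refine (integral_mono (hg.integrable_gridTime P hA t N) ((hi1.add hi2).const_mul B)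
        fun w => ?_).trans_eq ?_
      · by_cases hw : w ∈ gridHits m D
        · simp only [Pi.add_apply, indicator_of_mem hw]
          refine (hgB _ _).trans (le_mul_of_one_le_right hB ?_)
          linarith [show (0 : ℝ) ≤ gridTime A t N w / t by positivity]
        · simp only [Pi.add_apply, indicator_of_notMem hw, zero_add]
          rcases gridTime_eq_or_mem A t N w with h | h
          · rw [h, div_self ht0.ne', mul_one]
            exact hgB _ _
          · have hD' : X (gridTime A t N w) w ∉ D := by
              intro hmem
              refine hw ?_
              simp only [gridHits, mem_iUnion]
              exact ⟨n + 1, N, gridIdx A t N w, hmem⟩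
            have hrt : r < ‖X (gridTime A t N w) w‖ := by
              rcases h.1 with h' | h'
              · exact absurd h' hD'
              · exact not_le.1 fun hle => h' (mem_closedBall_zero_iff.2 hle)
            exact (hgr _ _ hrt).trans (by positivity)
      · rw [integral_const_mul, integral_add' hi1 hi2, integral_indicator_const _ hSm,
          integral_div]
        simp
    have h3 : g x i + 0 * ET - Kg * (ET - ET) ≤ B * (P.real (gridHits m D) + ET / t) :=
      le_of_tendsto_of_tendsto' (((hlim.sub_const ET).const_mul Kg).const_sub _)
        (((hlim.div_const _).const_add _).const_mul B) hgN
    rw [sub_self, mul_zero, sub_zero, zero_mul, add_zero] at h3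
    refine h3.trans ?_
    rw [← ht', mul_one_div]
    gcongr
  have hlim : Tendsto (fun n : ℕ => B * (P.real (gridHits m D) + F / c * (1 / ((n : ℝ) + 1))))
      atTop (𝓝 (B * (P.real (gridHits m D) + F / c * 0))) :=
    ((tendsto_one_div_add_atTop_nhds_zero_nat.const_mul _).const_add _).const_mul B
  rw [mul_zero, add_zero] at hlim
  exact ge_of_tendsto' hlim key

/-- If the coefficients satisfy the standing assumptions, `(P_{x,i})` are laws solving the martingale
problem for the generator, `D` is a bounded domain and condition (C2) holds with respect to `D × M`,
then the process is recurrent with respect to `D × M`. -/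
theorem recurrence_of_C2 {d m : ℕ} (hd : 1 ≤ d) (hm : 1 ≤ m)
    (C : Coeffs d m) (hC : C.Assumptions)
    (P : Rd d → Fin m → Measure (PathSpace d m)) (hP : ∀ x i, SolvesMP C x i (P x i))
    (D : Set (Rd d)) (hD : BddDomain D) (hC2 : C.ConditionC2 D) :
    Recurrent P (D ×ˢ (Set.univ : Set (Fin m))) := by
  intro x i _
  have := (hP x i).prob
  obtain ⟨V, hV, hV0, hGV, hVlim⟩ := hC2
  set p := (P x i).real (gridHits m D) with hp
  have key : ∀ k : ℕ, (max (1 - V x i * (1 / ((k : ℝ) + 1))) 0) ^ 3 ≤ p := by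
    intro k
    have hk : (0 : ℝ) < k + 1 := by positivity
    obtain ⟨n, hn⟩ := (hVlim.eventually_ge_atTop ((k : ℝ) + 1)).exists
    have hr : ∀ y j, (n : ℝ) ≤ ‖y‖ → (k : ℝ) + 1 ≤ V y j := fun y j hy =>
      hn.trans (csInf_le ⟨0, by rintro v ⟨y, j, -, rfl⟩; exact hV0 y j⟩ ⟨y, j, hy, rfl⟩)
    have hg := Coeffs.isCc2_cube_sub hV hr
    have h := (hP x i).le_measure_gridHits hC hd hD.1 hg (B := ((k : ℝ) + 1) ^ 3)
      (Nat.cast_nonneg n) (by positivity)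
      (fun y j => pow_le_pow_left₀ (le_max_right _ _)
        (max_le (by linarith [hV0 y j]) hk.le) 3)
      (fun y j hy => by simp [hr y j hy.le])
      (fun y hy j => hC.G_cube_sub_nonneg hV _ y j (hGV y hy j).1 (hGV y hy j).2 hg)
    have e : max ((k : ℝ) + 1 - V x i) 0 =
        ((k : ℝ) + 1) * max (1 - V x i * (1 / ((k : ℝ) + 1))) 0 := by
      rw [mul_max_of_nonneg _ _ hk.le, mul_zero, mul_sub, mul_one]
      congr 2
      field_simp
    rw [e, mul_pow] at h
    exact le_of_mul_le_mul_left h (by positivity)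
  have hlim : Tendsto (fun k : ℕ => (max (1 - V x i * (1 / ((k : ℝ) + 1))) 0) ^ 3) atTop
      (𝓝 ((max (1 - V x i * 0) 0) ^ 3)) :=
    (((tendsto_one_div_add_atTop_nhds_zero_nat.const_mul _).const_sub _).max
      tendsto_const_nhds).pow 3
  have h1 : 1 ≤ p := by
    have := le_of_tendsto' hlim key
    simpa using this
  refine le_antisymm prob_le_one (le_trans ?_ (measure_mono (gridHits_subset D)))
  rw [hp, measureReal_def] at h1
  simpa using (ENNReal.ofReal_le_iff_le_toReal (measure_ne_top _ _)).2 h1
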